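/- If I and J are nonempty abelian ideals with I ⊆ J, then τ(J) ≼ τ(I). In particular, if I and J are nonempty abelian ideals with τ(I) = τ(J) = μ and I ⊆ J, then every abelian ideal K with I ⊆ K ⊆ J also satisfies τ(K) = μ. -/

import Mathlib

open scoped BigOperators

/-- Data of a reduced irreducible crystallographic root system `Δ`, spanning a
`ℚ`-vector space `V` equipped with a Weyl-group-invariant inner product `B`,
together with a chosen system of positive roots `Pos` and the highest root `θ`. -/
structure RootSystemCtx (V : Type*) [AddCommGroup V] [Module ℚ V] where
  /-- the invariant inner product `( , )` -/
  B : V →ₗ[ℚ] V →ₗ[ℚ] ℚ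
  B_symm : ∀ x y : V, B x y = B y x
  B_posdef : ∀ x : V, x ≠ 0 → 0 < B x x
  /-- the set of roots -/
  Δ : Set V
  Δ_finite : Δ.Finite
  Δ_spans : Submodule.span ℚ Δ = ⊤
  zero_notMem_Δ : (0 : V) ∉ Δ
  neg_mem_Δ : ∀ α ∈ Δ, -α ∈ Δ
  reduced : ∀ α ∈ Δ, ∀ c : ℚ, c • α ∈ Δ → c = 1 ∨ c = -1
  crystallographic : ∀ α ∈ Δ, ∀ β ∈ Δ, ∃ n : ℤ, 2 * B α β / B β β = (n : ℚ)
  reflect_mem : ∀ α ∈ Δ, ∀ β ∈ Δ, β - (2 * B β α / B α α) • α ∈ Δ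
  irreducible : ∀ S : Set V, S ⊆ Δ → (∀ α ∈ S, ∀ β ∈ Δ \ S, B α β = 0) → S = ∅ ∨ S = Δ
  /-- the positive roots `Δ⁺` -/
  Pos : Set V
  pos_subset : Pos ⊆ Δ
  mem_pos_or_neg_pos : ∀ α ∈ Δ, α ∈ Pos ∨ -α ∈ Pos
  pos_not_neg : ∀ α ∈ Pos, -α ∉ Pos
  add_pos_mem : ∀ α ∈ Pos, ∀ β ∈ Pos, α + β ∈ Δ → α + β ∈ Pos
  /-- the highest root `θ` -/
  θ : V
  θ_pos : θ ∈ Pos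
  θ_highest : ∀ ν ∈ Δ, θ - ν ∈ AddSubmonoid.closure Pos

namespace RootSystemCtx

variable {V : Type*} [AddCommGroup V] [Module ℚ V] (ctx : RootSystemCtx V)

/-- the simple roots `Π`: indecomposable positive roots -/
def simple : Set V :=
  {α | α ∈ ctx.Pos ∧ ¬∃ β ∈ ctx.Pos, ∃ γ ∈ ctx.Pos, α = β + γ}

/-- `ρ`, the half-sum of all positive roots -/
noncomputable def ρ : V :=
  (1 / 2 : ℚ) • ∑ α ∈ (ctx.Δ_finite.subset ctx.pos_subset).toFinset, α

/-- the coroot `μ∨ = 2μ/(μ,μ)` -/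
noncomputable def coroot (μ : V) : V := (2 / ctx.B μ μ) • μ

/-- `Δ⁺_l`, the long positive roots (roots of the same length as `θ`) -/
def PosLong : Set V := {μ | μ ∈ ctx.Pos ∧ ctx.B μ μ = ctx.B ctx.θ ctx.θ}

/-- `Π_l`, the long simple roots -/
def SimpleLong : Set V := {μ | μ ∈ ctx.simple ∧ ctx.B μ μ = ctx.B ctx.θ ctx.θ}

/-- the dominance order `μ ≼ ν` on the root lattice: `ν - μ` is a nonnegative
integer combination of positive roots -/
def le (μ ν : V) : Prop := ν - μ ∈ AddSubmonoid.closure ctx.Pos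

/-- a (combinatorial) abelian ideal of `Δ⁺` -/
def IsAbelianIdeal (I : Set V) : Prop :=
  I ⊆ ctx.Pos ∧ (∀ μ ∈ I, ∀ ν ∈ I, μ + ν ∉ ctx.Δ) ∧
    ∀ γ ∈ I, ∀ ν ∈ ctx.Pos, γ + ν ∈ ctx.Δ → γ + ν ∈ I

/-- `γ` is a generator of the ideal `I` -/
def IsGenerator (I : Set V) (γ : V) : Prop := γ ∈ I ∧ ∀ α ∈ ctx.Pos, γ - α ∉ I

/-! ### The affine picture: `V̂ = V ⊕ ℚδ ⊕ ℚλ`, modelled as `V × ℚ × ℚ`,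
with `δ = (0,1,0)` and `λ = (0,0,1)`. -/

/-- the embedding of `V` into `V̂` -/
def emb (_ctx : RootSystemCtx V) (v : V) : V × ℚ × ℚ := (v, 0, 0)

/-- the imaginary root `δ` -/
def δhat (_ctx : RootSystemCtx V) : V × ℚ × ℚ := (0, 1, 0)

/-- the affine simple root `α₀ = δ - θ` -/
def alpha0 : V × ℚ × ℚ := (-ctx.θ, 1, 0)

/-- the extension of the inner product to `V̂`, with
`(δ,V)=(λ,V)=(δ,δ)=(λ,λ)=0` and `(δ,λ)=1` -/
noncomputable def Bhat : (V × ℚ × ℚ) →ₗ[ℚ] (V × ℚ × ℚ) →ₗ[ℚ] ℚ :=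
  LinearMap.mk₂ ℚ (fun x y => ctx.B x.1 y.1 + x.2.1 * y.2.2 + x.2.2 * y.2.1)
    (fun x x' y => by
      simp only [Prod.fst_add, Prod.snd_add, map_add, LinearMap.add_apply]; ring)
    (fun c x y => by
      simp only [Prod.smul_fst, Prod.smul_snd, map_smul, LinearMap.smul_apply,
        smul_eq_mul]; ring)
    (fun x y y' => by
      simp only [Prod.fst_add, Prod.snd_add, map_add]; ring)
    (fun c x y => by
      simp only [Prod.smul_fst, Prod.smul_snd, map_smul, smul_eq_mul]; ring)

/-- the set `Δ̂` of affine real roots -/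
def Δhat : Set (V × ℚ × ℚ) := {x | ∃ α ∈ ctx.Δ, ∃ k : ℤ, x = (α, (k : ℚ), 0)}

/-- the set `Δ̂⁺` of positive affine roots -/
def PosHat : Set (V × ℚ × ℚ) :=
  {x | ∃ α ∈ ctx.Pos, x = (α, 0, 0)} ∪
    {x | ∃ α ∈ ctx.Δ, ∃ k : ℤ, 1 ≤ k ∧ x = (α, (k : ℚ), 0)}

/-- the set `Π̂ = Π ∪ {α₀}` of affine simple roots -/
def SimpleHat : Set (V × ℚ × ℚ) :=
  {x | ∃ α ∈ ctx.simple, x = (α, (0 : ℚ), (0 : ℚ))} ∪ {ctx.alpha0}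

/-- the reflection `s_β : x ↦ x − (2(x,β)/(β,β))·β` in `V̂` -/
noncomputable def refl (β : V × ℚ × ℚ) : (V × ℚ × ℚ) ≃ₗ[ℚ] (V × ℚ × ℚ) :=
  if h : ctx.Bhat β β = 0 then LinearEquiv.refl ℚ _
  else
    Module.reflection (x := β) (f := (2 / ctx.Bhat β β) • ctx.Bhat β)
      (by simp only [LinearMap.smul_apply, smul_eq_mul]; field_simp)

/-- the affine Weyl group `Ŵ`, generated by the reflections `s_β`, `β ∈ Δ̂` -/
def What : Subgroup ((V × ℚ × ℚ) ≃ₗ[ℚ] (V × ℚ × ℚ)) :=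
  Subgroup.closure {g | ∃ β ∈ ctx.Δhat, g = ctx.refl β}

/-- the finite Weyl group `W`, generated by the reflections `s_α`, `α ∈ Δ`
(identified with a subgroup of `Ŵ`) -/
def Wfin : Subgroup ((V × ℚ × ℚ) ≃ₗ[ℚ] (V × ℚ × ℚ)) :=
  Subgroup.closure {g | ∃ α ∈ ctx.Δ, g = ctx.refl (α, (0 : ℚ), (0 : ℚ))}

/-- `N̂(w) = {β ∈ Δ̂⁺ : w(β) ∈ −Δ̂⁺}` -/
def Nhat (w : (V × ℚ × ℚ) ≃ₗ[ℚ] (V × ℚ × ℚ)) : Set (V × ℚ × ℚ) :=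
  {β | β ∈ ctx.PosHat ∧ -(w β) ∈ ctx.PosHat}

/-- a minuscule element of `Ŵ`: every element of `N̂(w)` has the form `δ - γ`
with `γ ∈ Δ⁺` -/
def IsMinuscule (w : (V × ℚ × ℚ) ≃ₗ[ℚ] (V × ℚ × ℚ)) : Prop :=
  w ∈ ctx.What ∧ ∀ β ∈ ctx.Nhat w, ∃ γ ∈ ctx.Pos, β = ctx.δhat - ctx.emb γ

/-- the abelian ideal `I_w` corresponding to a minuscule element `w` -/
def idealOf (w : (V × ℚ × ℚ) ≃ₗ[ℚ] (V × ℚ × ℚ)) : Set V :=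
  {γ | γ ∈ ctx.Pos ∧ ctx.δhat - ctx.emb γ ∈ ctx.Nhat w}

/-- the ideal `I` has rootlet `τ(I) = μ`, i.e. `I = I_w` for some minuscule `w`
with `w(α₀) + δ = μ` -/
def HasRootlet (I : Set V) (μ : V) : Prop :=
  ∃ w, ctx.IsMinuscule w ∧ ctx.idealOf w = I ∧ w ctx.alpha0 + ctx.δhat = ctx.emb μ

/-- `Ab_μ`, the set of nonempty abelian ideals with rootlet `μ` -/
def AbFiber (μ : V) : Set (Set V) := {I | I.Nonempty ∧ ctx.HasRootlet I μ}

/-- `N(u) = {γ ∈ Δ⁺ : u(γ) ∈ −Δ⁺}` for `u` in the finite Weyl group -/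
def Nfin (w : (V × ℚ × ℚ) ≃ₗ[ℚ] (V × ℚ × ℚ)) : Set V :=
  {γ | γ ∈ ctx.Pos ∧ -(w (ctx.emb γ)) ∈ ctx.PosHat}

/-- the length `l(u) = #N(u)` of an element of the finite Weyl group -/
noncomputable def lenFin (w : (V × ℚ × ℚ) ≃ₗ[ℚ] (V × ℚ × ℚ)) : ℕ :=
  (ctx.Nfin w).ncard

end RootSystemCtx
namespace RootSystemCtx

variable {V : Type*} [AddCommGroup V] [Module ℚ V] (ctx : RootSystemCtx V)

/-! ### Finite roots -/

lemma ne_zero_of_mem {α : V} (h : α ∈ ctx.Δ) : α ≠ 0 :=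
  fun h0 => ctx.zero_notMem_Δ (h0 ▸ h)

lemma B_self_pos {α : V} (h : α ∈ ctx.Δ) : 0 < ctx.B α α :=
  ctx.B_posdef α (ctx.ne_zero_of_mem h)

lemma B_self_nonneg (x : V) : 0 ≤ ctx.B x x := by
  by_cases h : x = 0
  · simp [h]
  · exact (ctx.B_posdef x h).le

/-- A negative integral pairing `2a/b` other than `-1` is at most `-2`. -/
lemma le_neg_of_pairing {a b : ℚ} (hb : 0 < b) (ha : a < 0) {n : ℤ}
    (hn : 2 * a / b = n) (h1 : n ≠ -1) : a ≤ -b := by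
  have h : 2 * a = n * b := by rw [← hn]; field_simp
  have hneg : n < 0 := by
    have : (n : ℚ) < 0 := by
      rw [← hn]; exact div_neg_of_neg_of_pos (by linarith) hb
    exact_mod_cast this
  have h2 : (n : ℚ) ≤ -2 := by
    have : n ≤ -2 := by omega
    exact_mod_cast this
  nlinarith

/-- The sum of two roots forming an obtuse angle is a root or zero. -/
lemma add_mem_of_B_neg {a b : V} (ha : a ∈ ctx.Δ) (hb : b ∈ ctx.Δ) (hab : ctx.B a b < 0)
    (h0 : a + b ≠ 0) : a + b ∈ ctx.Δ := by
  obtain ⟨n, hn⟩ := ctx.crystallographic a ha b hb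
  obtain ⟨m, hm⟩ := ctx.crystallographic b hb a ha
  by_cases h1 : n = -1
  · have := ctx.reflect_mem b hb a ha
    rw [hn, h1] at this
    simpa using this
  by_cases h2 : m = -1
  · have := ctx.reflect_mem a ha b hb
    rw [hm, h2] at this
    simpa [add_comm] using this
  have e1 := le_neg_of_pairing (ctx.B_self_pos hb) hab hn h1
  have e2 := le_neg_of_pairing (ctx.B_self_pos ha) (ctx.B_symm a b ▸ hab) hm h2
  have e3 := ctx.B_posdef _ h0
  simp only [map_add, LinearMap.add_apply] at e3
  rw [ctx.B_symm b a] at e2 e3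
  linarith

lemma add_ne_zero_of_pos {a b : V} (ha : a ∈ ctx.Pos) (hb : b ∈ ctx.Pos) : a + b ≠ 0 :=
  fun h => ctx.pos_not_neg a ha (neg_eq_of_add_eq_zero_right h ▸ hb)

lemma add_pos_of_B_neg {a b : V} (ha : a ∈ ctx.Pos) (hb : b ∈ ctx.Pos) (hab : ctx.B a b < 0) :
    a + b ∈ ctx.Pos :=
  ctx.add_pos_mem a ha b hb (ctx.add_mem_of_B_neg (ctx.pos_subset ha) (ctx.pos_subset hb) hab
    (ctx.add_ne_zero_of_pos ha hb))

lemma add_add_nsmul_ne_zero {a : V} (ha : a ∈ ctx.Pos) (n : ℕ) :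
    ∀ g ∈ ctx.Pos, ∀ e ∈ ctx.Pos, g + e + (n : ℚ) • a ≠ 0 := by
  induction n with
  | zero =>
    intro g hg e he
    simpa using ctx.add_ne_zero_of_pos hg he
  | succ n ih =>
    intro g hg e he h
    have h1 : ctx.B g a + ctx.B e a + ((n : ℚ) + 1) * ctx.B a a = 0 := by
      have := congrArg (fun x => ctx.B x a) h
      simpa using this
    have h2 := ctx.B_self_pos (ctx.pos_subset ha)
    have h3 : 0 < ((n : ℚ) + 1) * ctx.B a a := by positivity
    rcases lt_or_ge (ctx.B g a) 0 with h4 | h4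
    · refine ih (g + a) (ctx.add_pos_of_B_neg hg ha h4) e he ?_
      rw [← h]; push_cast; module
    · refine ih g hg (e + a) (ctx.add_pos_of_B_neg he ha (by linarith)) ?_
      rw [← h]; push_cast; module

/-- The reflection in a finite root. -/
def fs (a x : V) : V := x - (2 * ctx.B x a / ctx.B a a) • a

lemma B_fs_left {a : V} (ha : a ∈ ctx.Δ) (x : V) : ctx.B (ctx.fs a x) a = -ctx.B x a := by
  have := (ctx.B_self_pos ha).ne'
  simp only [fs, map_sub, map_smul, LinearMap.sub_apply, LinearMap.smul_apply, smul_eq_mul]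
  field_simp; ring

lemma B_fs_self {a : V} (ha : a ∈ ctx.Δ) (x : V) :
    ctx.B (ctx.fs a x) (ctx.fs a x) = ctx.B x x := by
  have := (ctx.B_self_pos ha).ne'
  simp only [fs, map_sub, map_smul, LinearMap.sub_apply, LinearMap.smul_apply, smul_eq_mul]
  rw [ctx.B_symm a x]
  field_simp; ring

lemma fs_fs {a : V} (ha : a ∈ ctx.Δ) (x : V) : ctx.fs a (ctx.fs a x) = x := by
  have h := ctx.B_fs_left ha x
  conv_lhs => rw [fs, h]
  rw [fs]; module

lemma fs_neg (a x : V) : ctx.fs a (-x) = -ctx.fs a x := by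
  simp only [fs, map_neg, LinearMap.neg_apply]
  module

lemma fs_pos {a g : V} (ha : a ∈ ctx.Pos) (hg : g ∈ ctx.Pos) (h : ctx.B g a ≤ 0) :
    ctx.fs a g ∈ ctx.Pos := by
  have had := ctx.pos_subset ha
  rcases ctx.mem_pos_or_neg_pos _ (ctx.reflect_mem a had g (ctx.pos_subset hg)) with h1 | h1
  · exact h1
  obtain ⟨n, hn⟩ := ctx.crystallographic g (ctx.pos_subset hg) a had
  have hn0 : n ≤ 0 := by
    have : (n : ℚ) ≤ 0 := by
      rw [← hn]; exact div_nonpos_of_nonpos_of_nonneg (by linarith) (ctx.B_self_pos had).le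
    exact_mod_cast this
  obtain ⟨k, rfl⟩ : ∃ k : ℕ, n = -k := ⟨n.natAbs, by omega⟩
  refine absurd ?_ (ctx.add_add_nsmul_ne_zero ha k g hg _ h1)
  rw [hn]; push_cast; module

/-! ### A height function -/

/-- The positive roots as a finset. -/
noncomputable def posFinset : Finset V := (ctx.Δ_finite.subset ctx.pos_subset).toFinset

lemma mem_posFinset {a : V} : a ∈ ctx.posFinset ↔ a ∈ ctx.Pos := by simp [posFinset]

/-- Pairing with the sum of the positive coroots. -/
noncomputable def ht : V →ₗ[ℚ] ℚ := ∑ g ∈ ctx.posFinset, (2 / ctx.B g g) • ctx.B g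

lemma ht_apply (x : V) : ctx.ht x = ∑ g ∈ ctx.posFinset, 2 * ctx.B x g / ctx.B g g := by
  simp only [ht, LinearMap.sum_apply, LinearMap.smul_apply, smul_eq_mul]
  refine Finset.sum_congr rfl fun g _ => ?_
  rw [ctx.B_symm x g]; ring

lemma ht_int {a : V} (ha : a ∈ ctx.Δ) : ∃ n : ℤ, ctx.ht a = n := by
  rw [ht_apply]
  refine Finset.sum_induction _ (fun q : ℚ => ∃ n : ℤ, q = n) ?_ ⟨0, by simp⟩ ?_
  · rintro _ _ ⟨n, rfl⟩ ⟨m, rfl⟩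
    exact ⟨n + m, by push_cast; rfl⟩
  · intro g hg
    exact ctx.crystallographic a ha g (ctx.pos_subset (ctx.mem_posFinset.1 hg))

open Classical in
lemma ht_pos {a : V} (ha : a ∈ ctx.Pos) : 0 < ctx.ht a := by
  have had := ctx.pos_subset ha
  set φ : V → V := fun g => if ctx.fs a g ∈ ctx.Pos then ctx.fs a g else -ctx.fs a g with hφ
  set c : V → ℚ := fun g => 2 * ctx.B a g / ctx.B g g with hc
  have hcneg : ∀ g, c (-g) = -c g := fun g => by simp [hc]; ring
  have hcfs : ∀ g, c (ctx.fs a g) = -c g := fun g => by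
    simp only [hc]
    rw [ctx.B_fs_self had, ctx.B_symm a (ctx.fs a g), ctx.B_fs_left had, ctx.B_symm a g]; ring
  have hφmem : ∀ g ∈ ctx.posFinset, φ g ∈ ctx.posFinset := by
    intro g hg
    rw [mem_posFinset] at hg ⊢
    simp only [hφ]
    split_ifs with h
    · exact h
    · exact (ctx.mem_pos_or_neg_pos _ (ctx.reflect_mem a had g (ctx.pos_subset hg))).resolve_left h
  have hφφ : ∀ g ∈ ctx.posFinset, φ (φ g) = g := by
    intro g hg
    rw [mem_posFinset] at hg
    simp only [hφ]
    split_ifs with h h1 h1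
    · exact ctx.fs_fs had g
    · exact absurd (by rwa [ctx.fs_fs had]) h1
    · rw [ctx.fs_neg, ctx.fs_fs had] at h1
      exact absurd h1 (ctx.pos_not_neg g hg)
    · rw [ctx.fs_neg, ctx.fs_fs had, neg_neg]
  have hsum : ∑ g ∈ ctx.posFinset, c (φ g) = ∑ g ∈ ctx.posFinset, c g :=
    Finset.sum_nbij' φ φ hφmem hφmem hφφ hφφ (fun _ _ => rfl)
  have hterm : ∀ g ∈ ctx.posFinset, 0 ≤ c g + c (φ g) := by
    intro g hg
    rw [mem_posFinset] at hg
    simp only [hφ]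
    split_ifs with h
    · rw [hcfs]; simp
    · rw [hcneg, hcfs, neg_neg]
      have h1 : 0 < ctx.B g a := by
        by_contra h1
        exact h (ctx.fs_pos ha hg (not_lt.1 h1))
      have h2 : 0 ≤ c g :=
        div_nonneg (by rw [ctx.B_symm]; linarith) (ctx.B_self_nonneg g)
      linarith
  have hfa : ctx.fs a a = -a := by
    have := (ctx.B_self_pos had).ne'
    rw [fs, mul_div_assoc, div_self this]; module
  have ha' : 0 < c a + c (φ a) := by
    have h1 : φ a = a := by
      simp only [hφ]
      rw [hfa, if_neg (ctx.pos_not_neg a ha), neg_neg]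
    have h2 : c a = 2 := by
      simp only [hc]
      rw [mul_div_assoc, div_self (ctx.B_self_pos had).ne', mul_one]
    rw [h1, h2]; norm_num
  have htot := Finset.sum_pos' hterm ⟨a, ctx.mem_posFinset.2 ha, ha'⟩
  rw [Finset.sum_add_distrib, hsum] at htot
  rw [ht_apply]
  change 0 < ∑ g ∈ ctx.posFinset, c g
  linarith

lemma eq_zero_or_ht_pos {x : V} (hx : x ∈ AddSubmonoid.closure ctx.Pos) :
    x = 0 ∨ 0 < ctx.ht x := by
  induction hx using AddSubmonoid.closure_induction with
  | mem x hx => exact Or.inr (ctx.ht_pos hx)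
  | zero => exact Or.inl rfl
  | add x y _ _ hx hy =>
    rcases hx with rfl | hx
    · simpa using hy
    rcases hy with rfl | hy
    · exact Or.inr (by simpa using hx)
    · exact Or.inr (by rw [map_add]; linarith)

lemma le_antisymm {x y : V} (hxy : ctx.le x y) (hyx : ctx.le y x) : x = y := by
  rcases ctx.eq_zero_or_ht_pos hxy with h | h
  · exact (sub_eq_zero.1 h).symm
  rcases ctx.eq_zero_or_ht_pos hyx with h' | h'
  · exact sub_eq_zero.1 h'
  rw [map_sub] at h h'
  linarith

lemma ht_le_highest {a : V} (ha : a ∈ ctx.Δ) : ctx.ht a ≤ ctx.ht ctx.θ := by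
  rcases ctx.eq_zero_or_ht_pos (ctx.θ_highest a ha) with h | h
  · rw [sub_eq_zero.1 h]
  · rw [map_sub] at h; linarith

lemma B_highest_nonneg {a : V} (ha : a ∈ ctx.Pos) : 0 ≤ ctx.B ctx.θ a := by
  by_contra! h
  have had := ctx.pos_subset ha
  have h1 := ctx.ht_le_highest (ctx.reflect_mem a had ctx.θ (ctx.pos_subset ctx.θ_pos))
  have h2 : 2 * ctx.B ctx.θ a / ctx.B a a < 0 :=
    div_neg_of_neg_of_pos (by linarith) (ctx.B_self_pos had)
  rw [map_sub, map_smul, smul_eq_mul] at h1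
  nlinarith [ctx.ht_pos ha]

/-! ### Affine roots -/

lemma posHat_subset {x : V × ℚ × ℚ} (hx : x ∈ ctx.PosHat) : x ∈ ctx.Δhat := by
  rcases hx with ⟨a, ha, rfl⟩ | ⟨a, ha, k, _, rfl⟩
  · exact ⟨a, ctx.pos_subset ha, 0, by simp⟩
  · exact ⟨a, ha, k, rfl⟩

lemma neg_mem_Δhat {x : V × ℚ × ℚ} (hx : x ∈ ctx.Δhat) : -x ∈ ctx.Δhat := by
  obtain ⟨a, ha, k, rfl⟩ := hx
  exact ⟨-a, ctx.neg_mem_Δ a ha, -k, by simp⟩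

lemma mem_posHat_or_neg {x : V × ℚ × ℚ} (hx : x ∈ ctx.Δhat) :
    x ∈ ctx.PosHat ∨ -x ∈ ctx.PosHat := by
  obtain ⟨a, ha, k, rfl⟩ := hx
  rcases lt_trichotomy k 0 with h | rfl | h
  · exact Or.inr (Or.inr ⟨-a, ctx.neg_mem_Δ a ha, -k, by omega, by simp⟩)
  · rcases ctx.mem_pos_or_neg_pos a ha with h | h
    · exact Or.inl (Or.inl ⟨a, h, by simp⟩)
    · exact Or.inr (Or.inl ⟨-a, h, by simp⟩)
  · exact Or.inl (Or.inr ⟨a, ha, k, h, rfl⟩)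

/-- A linear functional on the affine space which is positive and integral on positive roots. -/
noncomputable def htHat : (V × ℚ × ℚ) →ₗ[ℚ] ℚ :=
  ctx.ht ∘ₗ LinearMap.fst ℚ V (ℚ × ℚ) +
    (ctx.ht ctx.θ + 1) • (LinearMap.fst ℚ ℚ ℚ ∘ₗ LinearMap.snd ℚ V (ℚ × ℚ))

lemma htHat_apply (x : V × ℚ × ℚ) :
    ctx.htHat x = ctx.ht x.1 + (ctx.ht ctx.θ + 1) * x.2.1 := rfl

lemma htHat_pos {x : V × ℚ × ℚ} (hx : x ∈ ctx.PosHat) : 0 < ctx.htHat x := by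
  rw [htHat_apply]
  rcases hx with ⟨a, ha, rfl⟩ | ⟨a, ha, k, hk, rfl⟩
  · simpa using ctx.ht_pos ha
  · have h1 := ctx.ht_le_highest (ctx.neg_mem_Δ a ha)
    rw [map_neg] at h1
    have h2 := ctx.ht_pos ctx.θ_pos
    have h3 : (1 : ℚ) ≤ k := by exact_mod_cast hk
    simp only
    nlinarith

lemma htHat_int {x : V × ℚ × ℚ} (hx : x ∈ ctx.Δhat) : ∃ n : ℤ, ctx.htHat x = n := by
  obtain ⟨a, ha, k, rfl⟩ := hx
  obtain ⟨n, hn⟩ := ctx.ht_int ha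
  obtain ⟨m, hm⟩ := ctx.ht_int (ctx.pos_subset ctx.θ_pos)
  exact ⟨n + (m + 1) * k, by rw [htHat_apply, hn, hm]; push_cast; rfl⟩

lemma neg_notMem_posHat {x : V × ℚ × ℚ} (hx : x ∈ ctx.PosHat) : -x ∉ ctx.PosHat := by
  intro h
  have h1 := ctx.htHat_pos hx
  have h2 := ctx.htHat_pos h
  rw [map_neg] at h2
  linarith

lemma htHat_δhat_pos : 0 < ctx.htHat ctx.δhat := by
  have := ctx.ht_pos ctx.θ_pos
  simp only [htHat_apply, δhat, map_zero]
  linarith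

/-- Induction over positive affine roots along the height. -/
lemma posHat_induction {P : V × ℚ × ℚ → Prop}
    (h : ∀ b ∈ ctx.PosHat, (∀ e ∈ ctx.PosHat, ctx.htHat e < ctx.htHat b → P e) → P b) :
    ∀ b ∈ ctx.PosHat, P b := by
  have key : ∀ n : ℕ, ∀ b ∈ ctx.PosHat, ctx.htHat b < n → P b := by
    intro n
    induction n with
    | zero =>
      intro b hb hn
      have := ctx.htHat_pos hb
      push_cast at hn
      linarith
    | succ n ih =>
      intro b hb hn
      refine h b hb fun e he heb => ih e he ?_
      obtain ⟨p, hp⟩ := ctx.htHat_int (ctx.posHat_subset hb)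
      obtain ⟨q, hq⟩ := ctx.htHat_int (ctx.posHat_subset he)
      rw [hp] at hn heb
      rw [hq] at heb ⊢
      have h1 : q < p := by exact_mod_cast heb
      have h2 : p < n + 1 := by exact_mod_cast hn
      have : q < (n : ℤ) := by omega
      exact_mod_cast this
  intro b hb
  obtain ⟨n, hn⟩ := exists_nat_gt (ctx.htHat b)
  exact key n b hb hn

/-! ### Affine reflections -/

lemma Bhat_apply (x y : V × ℚ × ℚ) :
    ctx.Bhat x y = ctx.B x.1 y.1 + x.2.1 * y.2.2 + x.2.2 * y.2.1 := rfl

lemma Bhat_symm (x y : V × ℚ × ℚ) : ctx.Bhat x y = ctx.Bhat y x := by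
  rw [Bhat_apply, Bhat_apply, ctx.B_symm]; ring

lemma Bhat_self_pos {x : V × ℚ × ℚ} (hx : x ∈ ctx.Δhat) : 0 < ctx.Bhat x x := by
  obtain ⟨a, ha, k, rfl⟩ := hx
  simpa [Bhat_apply] using ctx.B_self_pos ha

lemma Bhat_δhat {x : V × ℚ × ℚ} (hx : x ∈ ctx.Δhat) : ctx.Bhat ctx.δhat x = 0 := by
  obtain ⟨a, ha, k, rfl⟩ := hx
  simp [Bhat_apply, δhat]

lemma Bhat_pairing_int {x b : V × ℚ × ℚ} (hx : x ∈ ctx.Δhat) (hb : b ∈ ctx.Δhat) :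
    ∃ n : ℤ, 2 * ctx.Bhat x b / ctx.Bhat b b = n := by
  obtain ⟨a, ha, k, rfl⟩ := hx
  obtain ⟨c, hc, j, rfl⟩ := hb
  simpa [Bhat_apply] using ctx.crystallographic a ha c hc

lemma refl_apply {b : V × ℚ × ℚ} (hb : b ∈ ctx.Δhat) (x : V × ℚ × ℚ) :
    ctx.refl b x = x - (2 * ctx.Bhat x b / ctx.Bhat b b) • b := by
  rw [refl, dif_neg (ctx.Bhat_self_pos hb).ne', Module.reflection_apply, LinearMap.smul_apply,
    smul_eq_mul, ctx.Bhat_symm b x]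
  congr 2; ring

lemma refl_self {b : V × ℚ × ℚ} (hb : b ∈ ctx.Δhat) : ctx.refl b b = -b := by
  rw [ctx.refl_apply hb, mul_div_assoc, div_self (ctx.Bhat_self_pos hb).ne']; module

lemma Bhat_refl {b : V × ℚ × ℚ} (hb : b ∈ ctx.Δhat) (x y : V × ℚ × ℚ) :
    ctx.Bhat (ctx.refl b x) (ctx.refl b y) = ctx.Bhat x y := by
  have := (ctx.Bhat_self_pos hb).ne'
  rw [ctx.refl_apply hb, ctx.refl_apply hb]
  simp only [map_sub, map_smul, LinearMap.sub_apply, LinearMap.smul_apply, smul_eq_mul]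
  rw [ctx.Bhat_symm b y]
  field_simp; ring

lemma refl_refl {b : V × ℚ × ℚ} (hb : b ∈ ctx.Δhat) (x : V × ℚ × ℚ) :
    ctx.refl b (ctx.refl b x) = x := by
  have := (ctx.Bhat_self_pos hb).ne'
  have h : ctx.Bhat (ctx.refl b x) b = -ctx.Bhat x b := by
    rw [ctx.refl_apply hb]
    simp only [map_sub, map_smul, LinearMap.sub_apply, LinearMap.smul_apply, smul_eq_mul]
    field_simp; ring
  rw [ctx.refl_apply hb (ctx.refl b x), h, ctx.refl_apply hb]; module

lemma refl_mul_self {b : V × ℚ × ℚ} (hb : b ∈ ctx.Δhat) : ctx.refl b * ctx.refl b = 1 :=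
  LinearEquiv.ext fun x => ctx.refl_refl hb x

lemma refl_neg {b : V × ℚ × ℚ} (hb : b ∈ ctx.Δhat) : ctx.refl (-b) = ctx.refl b := by
  refine LinearEquiv.ext fun x => ?_
  rw [ctx.refl_apply hb, ctx.refl_apply (ctx.neg_mem_Δhat hb)]
  simp only [map_neg, LinearMap.neg_apply, neg_neg]
  module

lemma refl_mem_Δhat {b x : V × ℚ × ℚ} (hb : b ∈ ctx.Δhat) (hx : x ∈ ctx.Δhat) :
    ctx.refl b x ∈ ctx.Δhat := by
  obtain ⟨n, hn⟩ := ctx.Bhat_pairing_int hx hb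
  have hr := ctx.refl_apply hb x
  obtain ⟨a, ha, k, rfl⟩ := hx
  obtain ⟨c, hc, j, rfl⟩ := hb
  refine ⟨_, ctx.reflect_mem c hc a ha, k - n * j, ?_⟩
  have hn' : 2 * ctx.B a c / ctx.B c c = n := by simpa [Bhat_apply] using hn
  rw [hr, hn, hn']
  simp

/-- Isometries permuting the affine real roots and fixing `δ`. -/
structure IsAut (g : (V × ℚ × ℚ) ≃ₗ[ℚ] (V × ℚ × ℚ)) : Prop where
  Bhat_map : ∀ x y, ctx.Bhat (g x) (g y) = ctx.Bhat x y
  mem_iff : ∀ x, g x ∈ ctx.Δhat ↔ x ∈ ctx.Δhat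
  map_δhat : g ctx.δhat = ctx.δhat

lemma isAut_refl {b : V × ℚ × ℚ} (hb : b ∈ ctx.Δhat) : ctx.IsAut (ctx.refl b) where
  Bhat_map := ctx.Bhat_refl hb
  mem_iff x := ⟨fun h => by simpa [ctx.refl_refl hb] using ctx.refl_mem_Δhat hb h,
    ctx.refl_mem_Δhat hb⟩
  map_δhat := by rw [ctx.refl_apply hb, ctx.Bhat_δhat hb]; simp

lemma isAut_of_mem_What {g : (V × ℚ × ℚ) ≃ₗ[ℚ] (V × ℚ × ℚ)} (hg : g ∈ ctx.What) :
    ctx.IsAut g := by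
  induction hg using Subgroup.closure_induction with
  | mem g hg =>
    obtain ⟨b, hb, rfl⟩ := hg
    exact ctx.isAut_refl hb
  | one => exact ⟨fun _ _ => rfl, fun _ => Iff.rfl, rfl⟩
  | mul g h _ _ hg hh =>
    exact ⟨fun x y => (hg.1 _ _).trans (hh.1 _ _), fun x => (hg.2 _).trans (hh.2 _),
      (congrArg g hh.3).trans hg.3⟩
  | inv g _ hg =>
    have hc : ∀ x, g (g⁻¹ x) = x := fun x => g.apply_symm_apply x
    refine ⟨fun x y => ?_, fun x => ?_, ?_⟩
    · rw [← hg.1, hc, hc]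
    · rw [← hg.2, hc]
    · apply g.injective
      rw [hc, hg.3]

lemma IsAut.conj_refl {ctx : RootSystemCtx V} {g : (V × ℚ × ℚ) ≃ₗ[ℚ] (V × ℚ × ℚ)}
    (hg : ctx.IsAut g) {b : V × ℚ × ℚ} (hb : b ∈ ctx.Δhat) :
    ctx.refl (g b) * g = g * ctx.refl b := by
  refine LinearEquiv.ext fun x => ?_
  change ctx.refl (g b) (g x) = g (ctx.refl b x)
  rw [ctx.refl_apply ((hg.mem_iff b).2 hb), ctx.refl_apply hb, hg.Bhat_map, hg.Bhat_map, map_sub,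
    map_smul]

/-! ### Simple affine roots -/

/-- The positive affine roots whose reflection permutes the other positive affine roots. -/
def SimpleRefl : Set (V × ℚ × ℚ) :=
  {b | b ∈ ctx.PosHat ∧ ∀ x ∈ ctx.PosHat, x ≠ b → ctx.refl b x ∈ ctx.PosHat}

lemma mem_Nhat_of_add {g : (V × ℚ × ℚ) ≃ₗ[ℚ] (V × ℚ × ℚ)} (hg : ctx.IsAut g)
    {b x y : V × ℚ × ℚ} (hb : b ∈ ctx.Nhat g) (hx : x ∈ ctx.PosHat) (hy : y ∈ ctx.PosHat)
    (h : x + y = b) : ∃ e ∈ ctx.Nhat g, ctx.htHat e < ctx.htHat b := by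
  subst h
  have hpx := ctx.htHat_pos hx
  have hpy := ctx.htHat_pos hy
  rcases ctx.mem_posHat_or_neg ((hg.mem_iff x).2 (ctx.posHat_subset hx)) with h1 | h1
  · rcases ctx.mem_posHat_or_neg ((hg.mem_iff y).2 (ctx.posHat_subset hy)) with h2 | h2
    · have h3 := ctx.htHat_pos hb.2
      have h4 := ctx.htHat_pos h1
      have h5 := ctx.htHat_pos h2
      rw [map_neg, map_add, map_add] at h3
      linarith
    · exact ⟨y, ⟨hy, h2⟩, by rw [map_add]; linarith⟩
  · exact ⟨x, ⟨hx, h1⟩, by rw [map_add]; linarith⟩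

lemma sub_δhat_mem_Nhat {g : (V × ℚ × ℚ) ≃ₗ[ℚ] (V × ℚ × ℚ)} (hg : ctx.IsAut g)
    {b : V × ℚ × ℚ} (hb : b ∈ ctx.Nhat g) {m : ℤ} (hm : 0 < m)
    (hbm : b - (m : ℚ) • ctx.δhat ∈ ctx.PosHat) :
    b - (m : ℚ) • ctx.δhat ∈ ctx.Nhat g := by
  refine ⟨hbm, ?_⟩
  have h1 : -(g (b - (m : ℚ) • ctx.δhat)) = -g b + (m : ℚ) • ctx.δhat := by
    rw [map_sub, map_smul, hg.map_δhat]; abel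
  rw [h1]
  rcases hb.2 with ⟨a, ha, h2⟩ | ⟨a, ha, k, hk, h2⟩ <;> rw [h2]
  · exact Or.inr ⟨a, ctx.pos_subset ha, m, hm, by simp [δhat]⟩
  · exact Or.inr ⟨a, ha, k + m, by omega, by simp [δhat]⟩

/-- Subtracting affine real roots at an acute angle gives a real root or a multiple of `δ`. -/
lemma sub_mem_Δhat {x b : V × ℚ × ℚ} (hx : x ∈ ctx.Δhat) (hb : b ∈ ctx.Δhat)
    (h : 0 < ctx.Bhat x b) : x - b ∈ ctx.Δhat ∨ ∃ m : ℤ, x = b + (m : ℚ) • ctx.δhat := by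
  obtain ⟨a, ha, k, rfl⟩ := hx
  obtain ⟨c, hc, j, rfl⟩ := hb
  by_cases hac : a = c
  · subst hac
    exact Or.inr ⟨k - j, by simp [δhat]⟩
  · refine Or.inl ⟨a - c, ?_, k - j, by simp⟩
    have h1 : 0 < ctx.B a c := by simpa [Bhat_apply] using h
    rw [sub_eq_add_neg]
    refine ctx.add_mem_of_B_neg ha (ctx.neg_mem_Δ c hc) (by simpa using h1) ?_
    rwa [← sub_eq_add_neg, sub_ne_zero]

lemma smul_sub_δhat_mem {b : V × ℚ × ℚ} (hb : b ∈ ctx.Δhat) {k m : ℚ} (hk : 0 ≤ k)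
    (h : k • b - m • ctx.δhat ∈ ctx.Δhat) : k = 1 := by
  obtain ⟨a, ha, j, rfl⟩ := hb
  obtain ⟨c, hc, i, h1⟩ := h
  have h2 : k • a = c := by simpa [δhat] using congrArg Prod.fst h1
  rcases ctx.reduced a ha k (h2 ▸ hc) with h3 | h3
  · exact h3
  · linarith

lemma exists_lt_of_add_eq_smul {g : (V × ℚ × ℚ) ≃ₗ[ℚ] (V × ℚ × ℚ)} (hg : ctx.IsAut g)
    {b : V × ℚ × ℚ} (hb : b ∈ ctx.Nhat g) (k : ℕ) :
    ∀ x ∈ ctx.PosHat, ∀ y ∈ ctx.PosHat, x ≠ b → y ≠ b → x + y = ((k : ℚ) + 1) • b →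
      ∃ e ∈ ctx.Nhat g, ctx.htHat e < ctx.htHat b := by
  have hbd := ctx.posHat_subset hb.1
  induction k with
  | zero =>
    intro x hx y hy _ _ h
    exact ctx.mem_Nhat_of_add hg hb hx hy (by simpa using h)
  | succ k ih =>
    have key : ∀ x ∈ ctx.PosHat, ∀ y ∈ ctx.PosHat, x ≠ b → y ≠ b →
        x + y = (((k + 1 : ℕ) : ℚ) + 1) • b → 0 < ctx.Bhat x b →
        ∃ e ∈ ctx.Nhat g, ctx.htHat e < ctx.htHat b := by
      intro x hx y hy hxb hyb h hpos
      push_cast at h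
      have descend : ∀ m : ℤ, 0 < m → b - (m : ℚ) • ctx.δhat ∈ ctx.PosHat →
          ∃ e ∈ ctx.Nhat g, ctx.htHat e < ctx.htHat b := by
        intro m hm h1
        refine ⟨_, ctx.sub_δhat_mem_Nhat hg hb hm h1, ?_⟩
        have h2 : (0 : ℚ) < m := by exact_mod_cast hm
        rw [map_sub, map_smul, smul_eq_mul]
        nlinarith [mul_pos h2 ctx.htHat_δhat_pos]
      rcases ctx.sub_mem_Δhat (ctx.posHat_subset hx) hbd hpos with h1 | ⟨m, rfl⟩
      · rcases ctx.mem_posHat_or_neg h1 with h2 | h2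
        · refine ih (x - b) h2 y hy ?_ hyb ?_
          · intro h3
            have h4 : (2 : ℚ) • b - (0 : ℚ) • ctx.δhat ∈ ctx.Δhat := by
              have : (2 : ℚ) • b - (0 : ℚ) • ctx.δhat = x := by
                rw [sub_eq_iff_eq_add.1 h3]; module
              rw [this]; exact ctx.posHat_subset hx
            have := ctx.smul_sub_δhat_mem hbd (by norm_num) h4
            norm_num at this
          · rw [sub_add_eq_add_sub, h]; module
        · exact ctx.mem_Nhat_of_add hg hb hx h2 (by abel)
      · rcases lt_trichotomy m 0 with hm | rfl | hm
        · refine descend (-m) (by omega) ?_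
          convert hx using 1
          push_cast; module
        · simp at hxb
        · have hy' : y = ((k : ℚ) + 1) • b - (m : ℚ) • ctx.δhat := by
            rw [← eq_sub_iff_add_eq'] at h
            rw [h]; module
          have hk := ctx.smul_sub_δhat_mem hbd (by positivity) (hy' ▸ ctx.posHat_subset hy)
          rw [hk, one_smul] at hy'
          exact descend m hm (hy' ▸ hy)
    intro x hx y hy hxb hyb h
    rcases lt_or_ge 0 (ctx.Bhat x b) with h1 | h1
    · exact key x hx y hy hxb hyb h h1
    · refine key y hy x hx hyb hxb (by rw [add_comm, h]) ?_
      have h2 := congrArg (fun z => ctx.Bhat z b) h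
      simp only [map_add, map_smul, LinearMap.add_apply, LinearMap.smul_apply, smul_eq_mul] at h2
      have h3 : 0 < (((k + 1 : ℕ) : ℚ) + 1) * ctx.Bhat b b :=
        mul_pos (by positivity) (ctx.Bhat_self_pos hbd)
      linarith

/-- A nonempty inversion set contains a simple affine root. -/
lemma exists_simple_mem_Nhat {g : (V × ℚ × ℚ) ≃ₗ[ℚ] (V × ℚ × ℚ)} (hg : ctx.IsAut g) :
    ∀ b ∈ ctx.PosHat, b ∈ ctx.Nhat g → ∃ s ∈ ctx.SimpleRefl, s ∈ ctx.Nhat g := by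
  refine ctx.posHat_induction fun b hb ih hbN => ?_
  by_cases hs : b ∈ ctx.SimpleRefl
  · exact ⟨b, hs, hbN⟩
  obtain ⟨x, hx, hxb, hxn⟩ : ∃ x ∈ ctx.PosHat, x ≠ b ∧ ctx.refl b x ∉ ctx.PosHat := by
    by_contra! h
    exact hs ⟨hb, h⟩
  have hbd := ctx.posHat_subset hb
  have hxd := ctx.posHat_subset hx
  have hy := (ctx.mem_posHat_or_neg (ctx.refl_mem_Δhat hbd hxd)).resolve_left hxn
  have hyb : -(ctx.refl b x) ≠ b := by
    intro h
    apply hxb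
    rw [← ctx.refl_refl hbd x, neg_eq_iff_eq_neg.1 h, map_neg, ctx.refl_self hbd, neg_neg]
  obtain ⟨n, hn⟩ := ctx.Bhat_pairing_int hxd hbd
  have hsum : x + -(ctx.refl b x) = (n : ℚ) • b := by
    rw [ctx.refl_apply hbd, hn]; abel
  have hnpos : 0 < n := by
    have h1 := congrArg ctx.htHat hsum
    rw [map_add, map_smul, smul_eq_mul] at h1
    have h2 : 0 < (n : ℚ) * ctx.htHat b := by
      rw [← h1]
      exact add_pos (ctx.htHat_pos hx) (ctx.htHat_pos hy)
    exact_mod_cast pos_of_mul_pos_left h2 (ctx.htHat_pos hb).le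
  obtain ⟨k, rfl⟩ : ∃ k : ℕ, n = k + 1 := ⟨(n - 1).toNat, by omega⟩
  obtain ⟨e, he, hlt⟩ := ctx.exists_lt_of_add_eq_smul hg hbN k x hx _ hy hxb hyb
    (by rw [hsum]; push_cast; rfl)
  exact ih e he.1 hlt he

/-! ### Words in simple reflections -/

/-- The product of the reflections in a list of roots. -/
noncomputable def word (L : List (V × ℚ × ℚ)) : (V × ℚ × ℚ) ≃ₗ[ℚ] (V × ℚ × ℚ) :=
  (L.map ctx.refl).prod

lemma word_cons (s : V × ℚ × ℚ) (L : List (V × ℚ × ℚ)) :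
    ctx.word (s :: L) = ctx.refl s * ctx.word L := by
  simp [word]

lemma word_append (L L' : List (V × ℚ × ℚ)) :
    ctx.word (L ++ L') = ctx.word L * ctx.word L' := by
  simp [word]

lemma word_singleton (s : V × ℚ × ℚ) : ctx.word [s] = ctx.refl s := by
  simp [word]

/-- The elements that are products of simple reflections. -/
def IsWord (g : (V × ℚ × ℚ) ≃ₗ[ℚ] (V × ℚ × ℚ)) : Prop :=
  ∃ L : List (V × ℚ × ℚ), (∀ s ∈ L, s ∈ ctx.SimpleRefl) ∧ g = ctx.word L

lemma isWord_refl_simple {s : V × ℚ × ℚ} (hs : s ∈ ctx.SimpleRefl) : ctx.IsWord (ctx.refl s) :=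
  ⟨[s], by simpa using hs, (ctx.word_singleton s).symm⟩

lemma isWord_mul {g h : (V × ℚ × ℚ) ≃ₗ[ℚ] (V × ℚ × ℚ)} (hg : ctx.IsWord g)
    (hh : ctx.IsWord h) : ctx.IsWord (g * h) := by
  obtain ⟨L, hL, rfl⟩ := hg
  obtain ⟨L', hL', rfl⟩ := hh
  refine ⟨L ++ L', fun s hs => ?_, (ctx.word_append L L').symm⟩
  rcases List.mem_append.1 hs with h | h
  exacts [hL s h, hL' s h]

lemma simple_mem_Δhat {s : V × ℚ × ℚ} (hs : s ∈ ctx.SimpleRefl) : s ∈ ctx.Δhat :=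
  ctx.posHat_subset hs.1

lemma isWord_inv {g : (V × ℚ × ℚ) ≃ₗ[ℚ] (V × ℚ × ℚ)} (hg : ctx.IsWord g) :
    ctx.IsWord g⁻¹ := by
  obtain ⟨L, hL, rfl⟩ := hg
  induction L with
  | nil => exact ⟨[], by simp, by simp [word]⟩
  | cons s L ih =>
    have hs := hL s List.mem_cons_self
    rw [word_cons, mul_inv_rev,
      inv_eq_of_mul_eq_one_right (ctx.refl_mul_self (ctx.simple_mem_Δhat hs))]
    exact ctx.isWord_mul (ih fun t ht => hL t (List.mem_cons_of_mem _ ht))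
      (ctx.isWord_refl_simple hs)

lemma isWord_refl_of_posHat : ∀ b ∈ ctx.PosHat, ctx.IsWord (ctx.refl b) := by
  refine ctx.posHat_induction fun b hb ih => ?_
  have hbd := ctx.posHat_subset hb
  obtain ⟨s, hs, hsN⟩ := ctx.exists_simple_mem_Nhat (ctx.isAut_refl hbd) b hb
    ⟨hb, by rw [ctx.refl_self hbd, neg_neg]; exact hb⟩
  by_cases hbs : b = s
  · exact hbs ▸ ctx.isWord_refl_simple hs
  have hsd := ctx.simple_mem_Δhat hs
  have hpos : 0 < ctx.Bhat s b := by
    by_contra! h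
    have h1 := ctx.htHat_pos hsN.2
    have h2 : 2 * ctx.Bhat s b / ctx.Bhat b b ≤ 0 :=
      div_nonpos_of_nonpos_of_nonneg (by linarith) (ctx.Bhat_self_pos hbd).le
    rw [ctx.refl_apply hbd, map_neg, map_sub, map_smul, smul_eq_mul] at h1
    nlinarith [ctx.htHat_pos hb, ctx.htHat_pos hs.1]
  have hlt : ctx.htHat (ctx.refl s b) < ctx.htHat b := by
    have h2 : 0 < 2 * ctx.Bhat b s / ctx.Bhat s s :=
      div_pos (by rw [ctx.Bhat_symm]; linarith) (ctx.Bhat_self_pos hsd)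
    rw [ctx.refl_apply hsd, map_sub, map_smul, smul_eq_mul]
    nlinarith [mul_pos h2 (ctx.htHat_pos hs.1)]
  have hw := ih _ (hs.2 b hb hbs) hlt
  have hconj := (ctx.isAut_refl hsd).conj_refl hbd
  have : ctx.refl b = ctx.refl s * (ctx.refl (ctx.refl s b) * ctx.refl s) := by
    rw [hconj, ← mul_assoc, ctx.refl_mul_self hsd, one_mul]
  rw [this]
  have hsw := ctx.isWord_refl_simple hs
  exact ctx.isWord_mul hsw (ctx.isWord_mul hw hsw)

lemma isWord_of_mem_What {g : (V × ℚ × ℚ) ≃ₗ[ℚ] (V × ℚ × ℚ)} (hg : g ∈ ctx.What) :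
    ctx.IsWord g := by
  induction hg using Subgroup.closure_induction with
  | mem g hg =>
    obtain ⟨b, hb, rfl⟩ := hg
    rcases ctx.mem_posHat_or_neg hb with h | h
    · exact ctx.isWord_refl_of_posHat b h
    · exact ctx.refl_neg hb ▸ ctx.isWord_refl_of_posHat _ h
  | one => exact ⟨[], by simp, by simp [word]⟩
  | mul g h _ _ hg hh => exact ctx.isWord_mul hg hh
  | inv g _ hg => exact ctx.isWord_inv hg

lemma word_mem_What {L : List (V × ℚ × ℚ)} (hL : ∀ s ∈ L, s ∈ ctx.SimpleRefl) :
    ctx.word L ∈ ctx.What := by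
  refine Subgroup.list_prod_mem _ fun g hg => ?_
  obtain ⟨s, hs, rfl⟩ := List.mem_map.1 hg
  exact Subgroup.subset_closure ⟨s, ctx.simple_mem_Δhat (hL s hs), rfl⟩

/-- The exchange condition. -/
lemma exchange {s : V × ℚ × ℚ} (hs : s ∈ ctx.SimpleRefl) (L : List (V × ℚ × ℚ))
    (hL : ∀ t ∈ L, t ∈ ctx.SimpleRefl) (hneg : -(ctx.word L s) ∈ ctx.PosHat) :
    ∃ L' : List (V × ℚ × ℚ), (∀ t ∈ L', t ∈ ctx.SimpleRefl) ∧ L'.length + 1 = L.length ∧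
      ctx.word L * ctx.refl s = ctx.word L' := by
  have hsd := ctx.simple_mem_Δhat hs
  induction L with
  | nil => exact absurd hneg (ctx.neg_notMem_posHat hs.1)
  | cons a L ih =>
    have ha := hL a List.mem_cons_self
    have hL1 : ∀ t ∈ L, t ∈ ctx.SimpleRefl := fun t ht => hL t (List.mem_cons_of_mem _ ht)
    have haut := ctx.isAut_of_mem_What (ctx.word_mem_What hL1)
    rcases ctx.mem_posHat_or_neg ((haut.mem_iff s).2 hsd) with h | h
    · have heq : ctx.word L s = a := by
        by_contra hne
        refine ctx.neg_notMem_posHat (ha.2 _ h hne) ?_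
        rw [word_cons] at hneg
        exact hneg
      refine ⟨L, hL1, by simp, ?_⟩
      rw [word_cons, mul_assoc, ← haut.conj_refl hsd, heq, ← mul_assoc,
        ctx.refl_mul_self (ctx.simple_mem_Δhat ha), one_mul]
    · obtain ⟨L', hL', hlen, he⟩ := ih hL1 h
      refine ⟨a :: L', ?_, by simp [hlen], ?_⟩
      · intro t ht
        rcases List.mem_cons.1 ht with rfl | ht
        exacts [ha, hL' t ht]
      · rw [word_cons, word_cons, mul_assoc, he]

/-- A real root antidominant on the inversions of `word L` is moved up by `word L`. -/
lemma word_sub_mem_closure (n : ℕ) : ∀ L : List (V × ℚ × ℚ), L.length = n →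
    (∀ s ∈ L, s ∈ ctx.SimpleRefl) → ∀ x ∈ ctx.Δhat,
    (∀ v ∈ ctx.Nhat (ctx.word L), ctx.Bhat x v ≤ 0) →
    ctx.word L x - x ∈ AddSubmonoid.closure ctx.PosHat := by
  induction n using Nat.strong_induction_on with
  | _ n ih =>
    intro L hlen hL x hx hanti
    rcases List.eq_nil_or_concat L with rfl | ⟨L1, s, rfl⟩
    · simp [word]
    rw [List.concat_eq_append] at hlen hL hanti ⊢
    have hs : s ∈ ctx.SimpleRefl := hL s (by simp)
    have hL1 : ∀ t ∈ L1, t ∈ ctx.SimpleRefl := fun t ht => hL t (by simp [ht])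
    have hlen' : L1.length + 1 = n := by simpa using hlen
    have hsd := ctx.simple_mem_Δhat hs
    have haut := ctx.isAut_of_mem_What (ctx.word_mem_What hL1)
    rw [word_append, word_singleton] at hanti ⊢
    rcases ctx.mem_posHat_or_neg ((haut.mem_iff s).2 hsd) with h | h
    · have hxs : ctx.Bhat x s ≤ 0 := by
        refine hanti s ⟨hs.1, ?_⟩
        change -(ctx.word L1 (ctx.refl s s)) ∈ _
        rwa [ctx.refl_self hsd, map_neg, neg_neg]
      have h1 := ih L1.length (by omega) L1 rfl hL1 (ctx.refl s x) (ctx.refl_mem_Δhat hsd hx) (by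
        intro v hv
        have hvs : v ≠ s := by
          rintro rfl
          exact ctx.neg_notMem_posHat h hv.2
        rw [← ctx.Bhat_refl hsd, ctx.refl_refl hsd]
        refine hanti _ ⟨hs.2 v hv.1 hvs, ?_⟩
        change -(ctx.word L1 (ctx.refl s (ctx.refl s v))) ∈ _
        rw [ctx.refl_refl hsd]
        exact hv.2)
      obtain ⟨m, hm⟩ := ctx.Bhat_pairing_int hx hsd
      have hm0 : m ≤ 0 := by
        have : (m : ℚ) ≤ 0 := by
          rw [← hm]
          exact div_nonpos_of_nonpos_of_nonneg (by linarith) (ctx.Bhat_self_pos hsd).le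
        exact_mod_cast this
      obtain ⟨k, rfl⟩ : ∃ k : ℕ, m = -k := ⟨m.natAbs, by omega⟩
      have h2 : ctx.refl s x - x = k • s := by
        rw [ctx.refl_apply hsd, hm]
        push_cast
        rw [← Nat.cast_smul_eq_nsmul ℚ]; module
      have h3 : (ctx.word L1 * ctx.refl s) x - x =
          (ctx.word L1 (ctx.refl s x) - ctx.refl s x) + k • s := by
        rw [← h2, LinearEquiv.mul_apply]; abel
      rw [h3]
      exact add_mem h1 (nsmul_mem (AddSubmonoid.subset_closure hs.1) k)
    · obtain ⟨L', hL', hl, he⟩ := ctx.exchange hs L1 hL1 h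
      rw [he] at hanti ⊢
      exact ih L'.length (by omega) L' rfl hL' x hx hanti

lemma fst_mem_closure_of_mem_closure {x : V × ℚ × ℚ}
    (hx : x ∈ AddSubmonoid.closure ctx.PosHat) :
    0 ≤ x.2.1 ∧ (x.2.1 = 0 → x.1 ∈ AddSubmonoid.closure ctx.Pos) := by
  induction hx using AddSubmonoid.closure_induction with
  | mem x hx =>
    rcases hx with ⟨a, ha, rfl⟩ | ⟨a, ha, k, hk, rfl⟩
    · exact ⟨le_rfl, fun _ => AddSubmonoid.subset_closure ha⟩
    · have : (1 : ℚ) ≤ k := by exact_mod_cast hk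
      exact ⟨by simp only; linarith, fun h => by simp only at h; linarith⟩
  | zero => exact ⟨le_rfl, fun _ => zero_mem _⟩
  | add x y _ _ hx hy =>
    refine ⟨add_nonneg hx.1 hy.1, fun h => ?_⟩
    have h' : x.2.1 + y.2.1 = 0 := h
    exact add_mem (hx.2 (by linarith [hx.1, hy.1])) (hy.2 (by linarith [hx.1, hy.1]))

lemma alpha0_mem_Δhat : ctx.alpha0 ∈ ctx.Δhat :=
  ⟨-ctx.θ, ctx.neg_mem_Δ _ (ctx.pos_subset ctx.θ_pos), 1, by simp [alpha0]⟩

/-- The rootlet reverses inclusion of ideals. -/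
lemma rootlet_antitone {I J : Set V} {μ ν : V} (hI : ctx.HasRootlet I μ)
    (hJ : ctx.HasRootlet J ν) (hIJ : I ⊆ J) : ctx.le ν μ := by
  obtain ⟨w, ⟨hw, hwmin⟩, rfl, hwμ⟩ := hI
  obtain ⟨z, ⟨hz, hzmin⟩, rfl, hzν⟩ := hJ
  have hsub : ∀ b ∈ ctx.Nhat w, b ∈ ctx.Nhat z := by
    intro b hb
    obtain ⟨g, hg, rfl⟩ := hwmin b hb
    exact (hIJ ⟨hg, hb⟩).2
  have hwa := ctx.isAut_of_mem_What hw
  have hinv : ∀ x, w (w⁻¹ x) = x := fun x => w.apply_symm_apply x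
  have hinv' : ∀ x, w⁻¹ (w x) = x := fun x => w.symm_apply_apply x
  have hu : z * w⁻¹ ∈ ctx.What := mul_mem hz (inv_mem hw)
  obtain ⟨L, hL, hLu⟩ := ctx.isWord_of_mem_What hu
  have hx : -(w ctx.alpha0) ∈ ctx.Δhat :=
    ctx.neg_mem_Δhat ((hwa.mem_iff _).2 ctx.alpha0_mem_Δhat)
  have hmem := ctx.word_sub_mem_closure L.length L rfl hL _ hx (by
    rw [← hLu]
    intro v hv
    have hv2 : -(z (w⁻¹ v)) ∈ ctx.PosHat := hv.2
    have hκ : w⁻¹ v ∈ ctx.Δhat := by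
      rw [← hwa.mem_iff, hinv]
      exact ctx.posHat_subset hv.1
    rcases ctx.mem_posHat_or_neg hκ with h | h
    · obtain ⟨g, hg, hge⟩ := hzmin _ ⟨h, hv2⟩
      have h1 : ctx.Bhat (-(w ctx.alpha0)) v = -ctx.Bhat ctx.alpha0 (w⁻¹ v) := by
        rw [map_neg, LinearMap.neg_apply, ← hwa.Bhat_map ctx.alpha0, hinv]
      rw [h1, hge]
      simpa [Bhat_apply, alpha0, δhat, emb] using ctx.B_highest_nonneg hg
    · have h1 : -(w⁻¹ v) ∈ ctx.Nhat w := ⟨h, by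
        rw [map_neg, neg_neg, hinv]; exact hv.1⟩
      have h2 := (hsub _ h1).2
      rw [map_neg] at h2
      exact absurd h2 (ctx.neg_notMem_posHat hv2))
  have hdiff : ctx.word L (-(w ctx.alpha0)) - -(w ctx.alpha0) = (μ - ν, 0, 0) := by
    rw [← hLu, LinearEquiv.mul_apply, map_neg, map_neg, hinv', eq_sub_of_add_eq hwμ,
      eq_sub_of_add_eq hzν]
    refine Prod.ext ?_ (Prod.ext (by simp [emb, δhat]) (by simp [emb, δhat]))
    simp only [emb, δhat, Prod.fst_sub, Prod.fst_neg]
    abel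
  rw [hdiff] at hmem
  exact (ctx.fst_mem_closure_of_mem_closure hmem).2 rfl

end RootSystemCtx

/-- Corollary `compare`: if `I ⊆ J` are nonempty abelian ideals,
then `τ(J) ≼ τ(I)`; in particular any abelian ideal between two ideals with the
same rootlet has that rootlet. -/
theorem statement_9 {V : Type*} [AddCommGroup V] [Module ℚ V] (ctx : RootSystemCtx V)
    (I J : Set V) (μI μJ : V) (hIne : I.Nonempty) (hJne : J.Nonempty)
    (hI : ctx.HasRootlet I μI) (hJ : ctx.HasRootlet J μJ) (hIJ : I ⊆ J) :
    ctx.le μJ μI ∧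
      (μI = μJ → ∀ (K : Set V) (μK : V), ctx.IsAbelianIdeal K → I ⊆ K → K ⊆ J →
        ctx.HasRootlet K μK → μK = μI) := by
  exact ⟨ctx.rootlet_antitone hI hJ hIJ, fun hμ K μK _ hIK hKJ hK =>
    ctx.le_antisymm (ctx.rootlet_antitone hI hK hIK) (hμ ▸ ctx.rootlet_antitone hK hJ hKJ)⟩
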